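/- arXiv:2105.08339 — 2 statements merged into one kernel-verified Lean document; each statement's English description precedes it below -/
import Mathlib

section
/- Fix d ≥ 2 and let Z be a standard Gaussian vector in ℝ^d, so that T = Z/‖Z‖₂ is uniformly distributed on the unit sphere S^{d−1}. Then E[‖T‖₁] = 2d/((d−1)·B(1/2,(d−1)/2)), where B denotes the Beta function. -/
open MeasureTheory BigOperators Real

/-- The law of a standard Gaussian vector in `ℝ^d`: the product of `d` standard
normal distributions. -/
noncomputable def stdGaussian (d : ℕ) : Measure (Fin d → ℝ) :=
  Measure.pi fun _ => ProbabilityTheory.gaussianReal 0 1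

/-- The Beta function `B(a,b) = Γ(a)Γ(b)/Γ(a+b)`. -/
noncomputable def realBeta (a b : ℝ) : ℝ :=
  Real.Gamma a * Real.Gamma b / Real.Gamma (a + b)

/-- Integration in polar coordinates of a product of a radial and an angular function. -/
lemma integral_norm_mul_direction {E : Type*} [NormedAddCommGroup E] [NormedSpace ℝ E]
    [MeasurableSpace E] [BorelSpace E] [FiniteDimensional ℝ E] [Nontrivial E]
    (μ : Measure E) [μ.IsAddHaarMeasure] (f : ℝ → ℝ) (g : E → ℝ) :
    ∫ x, g (‖x‖⁻¹ • x) * f ‖x‖ ∂μ =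
      (∫ u, g (u : Metric.sphere (0 : E) 1) ∂μ.toSphere) *
        ∫ y in Set.Ioi (0 : ℝ), y ^ (Module.finrank ℝ E - 1) * f y :=
  calc
    ∫ x, g (‖x‖⁻¹ • x) * f ‖x‖ ∂μ
      = ∫ x : ({(0)}ᶜ : Set E), g (‖x.1‖⁻¹ • x.1) * f ‖x.1‖ ∂(μ.comap (↑)) := by
      rw [integral_subtype_comap (measurableSet_singleton _).compl
        fun x ↦ g (‖x‖⁻¹ • x) * f ‖x‖, restrict_compl_singleton]
    _ = ∫ x, g x.1 * f x.2 ∂μ.toSphere.prod (.volumeIoiPow (Module.finrank ℝ E - 1)) := by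
      simpa using μ.measurePreserving_homeomorphUnitSphereProd.integral_comp
        (Homeomorph.measurableEmbedding _)
        (fun x : Metric.sphere (0 : E) 1 × Set.Ioi (0 : ℝ) ↦ g x.1 * f x.2)
    _ = (∫ u, g (u : Metric.sphere (0 : E) 1) ∂μ.toSphere) *
          ∫ x : Set.Ioi (0 : ℝ), f x ∂.volumeIoiPow (Module.finrank ℝ E - 1) :=
      integral_prod_mul (fun u : Metric.sphere (0 : E) 1 ↦ g u) fun x : Set.Ioi (0 : ℝ) ↦ f x
    _ = _ := by
      simp only [Measure.volumeIoiPow, ENNReal.ofReal]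
      rw [integral_withDensity_eq_integral_smul,
        integral_subtype_comap measurableSet_Ioi
          fun a ↦ Real.toNNReal (a ^ (Module.finrank ℝ E - 1)) • f a,
        setIntegral_congr_fun measurableSet_Ioi fun x hx ↦ ?_]
      · rw [NNReal.smul_def, Real.coe_toNNReal _ (pow_nonneg hx.out.le _), smul_eq_mul]
      · exact (measurable_subtype_coe.pow_const _).real_toNNReal

open ProbabilityTheory in
lemma stdGaussian_eq_withDensity (d : ℕ) :
    stdGaussian d =
      volume.withDensity fun x ↦ ENNReal.ofReal (∏ i, gaussianPDFReal 0 1 (x i)) := by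
  refine Measure.pi_eq fun s hs ↦ ?_
  rw [withDensity_apply _ (MeasurableSet.univ_pi hs), volume_pi, Measure.restrict_pi_pi,
    ← ofReal_integral_eq_lintegral_ofReal
      (Integrable.fintype_prod fun i ↦ (integrable_gaussianPDFReal 0 1).restrict)
      (.of_forall fun x ↦ Finset.prod_nonneg fun i _ ↦ gaussianPDFReal_nonneg 0 1 (x i)),
    integral_fintype_prod_eq_prod fun _ : Fin d ↦ gaussianPDFReal 0 1,
    ENNReal.ofReal_prod_of_nonneg fun i _ ↦ integral_nonneg (gaussianPDFReal_nonneg 0 1)]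
  exact Finset.prod_congr rfl fun i _ ↦
    (gaussianReal_apply_eq_integral 0 one_ne_zero (s i)).symm

open ProbabilityTheory in
lemma integral_stdGaussian (d : ℕ) (h : EuclideanSpace ℝ (Fin d) → ℝ) :
    ∫ z, h (WithLp.toLp 2 z) ∂stdGaussian d =
      (√(2 * π))⁻¹ ^ d * ∫ x, h x * exp (-(1 / 2) * ‖x‖ ^ 2) := by
  have hm : Measurable fun x : Fin d → ℝ ↦ ∏ i, gaussianPDFReal 0 1 (x i) :=
    Finset.measurable_prod _ fun i _ ↦
      (measurable_gaussianPDFReal 0 1).comp (measurable_pi_apply i)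
  rw [stdGaussian_eq_withDensity, integral_withDensity_eq_integral_toReal_smul
    hm.ennreal_ofReal (by simp), ← integral_const_mul,
    ← (PiLp.volume_preserving_toLp (Fin d)).integral_comp
      (MeasurableEquiv.toLp 2 (Fin d → ℝ)).measurableEmbedding]
  refine integral_congr_ae (.of_forall fun x ↦ ?_)
  have hprod : ∏ i, gaussianPDFReal 0 1 (x i) =
      (√(2 * π))⁻¹ ^ d * exp (-(1 / 2) * ∑ i, x i ^ 2) := by
    simp only [gaussianPDFReal, Finset.prod_mul_distrib, ← exp_sum, Finset.mul_sum]
    congr 1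
    · simp
    · congr 1
      refine Finset.sum_congr rfl fun i _ ↦ ?_
      simp only [sub_zero, NNReal.coe_one]
      ring
  simp only [smul_eq_mul]
  rw [ENNReal.toReal_ofReal (Finset.prod_nonneg fun i _ ↦ gaussianPDFReal_nonneg 0 1 (x i)),
    hprod, EuclideanSpace.norm_sq_eq]
  simp only [norm_eq_abs, sq_abs]
  ring

lemma integral_pow_mul_exp_neg_half_sq (n : ℕ) :
    ∫ y in Set.Ioi (0 : ℝ), y ^ n * exp (-(1 / 2) * y ^ 2) =
      (1 / 2) ^ (-((n : ℝ) + 1) / 2) * (1 / 2) * Gamma (((n : ℝ) + 1) / 2) := by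
  have h := integral_rpow_mul_exp_neg_mul_rpow (p := 2) (q := n) (b := 1 / 2) two_pos
    (by linarith [Nat.cast_nonneg (α := ℝ) n]) (by norm_num)
  simpa only [rpow_natCast, rpow_two] using h

lemma integral_abs_gaussianReal :
    ∫ x, |x| ∂ProbabilityTheory.gaussianReal 0 1 = 2 * (√(2 * π))⁻¹ := by
  have h := integral_pow_mul_exp_neg_half_sq 1
  rw [ProbabilityTheory.integral_gaussianReal_eq_integral_smul one_ne_zero]
  have hfun (x : ℝ) : ProbabilityTheory.gaussianPDFReal 0 1 x • |x| =
      (√(2 * π))⁻¹ * (|x| ^ 1 * exp (-(1 / 2) * |x| ^ 2)) := by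
    simp only [ProbabilityTheory.gaussianPDFReal, smul_eq_mul, sq_abs]
    simp
    ring_nf
  simp_rw [hfun]
  rw [integral_const_mul, integral_comp_abs (f := fun y ↦ y ^ 1 * exp (-(1 / 2) * y ^ 2)), h]
  norm_num [rpow_neg_one]
  ring

lemma integrable_abs_gaussianReal :
    Integrable (fun x : ℝ ↦ |x|) (ProbabilityTheory.gaussianReal 0 1) :=
  ((ProbabilityTheory.memLp_id_gaussianReal 1).integrable (by simp)).abs

lemma integral_sum_abs_stdGaussian (d : ℕ) :
    ∫ z, ∑ i, |z i| ∂stdGaussian d = d * (2 * (√(2 * π))⁻¹) := by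
  unfold stdGaussian
  rw [integral_finsetSum _ fun i _ ↦ integrable_comp_eval integrable_abs_gaussianReal]
  have h (i : Fin d) : ∫ z : Fin d → ℝ, |z i|
      ∂Measure.pi (fun _ ↦ ProbabilityTheory.gaussianReal 0 1) = 2 * (√(2 * π))⁻¹ := by
    rw [integral_comp_eval (μ := fun _ : Fin d ↦ ProbabilityTheory.gaussianReal 0 1)
      (f := fun x : ℝ ↦ |x|) continuous_abs.aestronglyMeasurable, integral_abs_gaussianReal]
  simp [h]

theorem sphere_l1_expectation (d : ℕ) (hd : 2 ≤ d) :
    (∫ z, (∑ i, |z i|) / Real.sqrt (∑ i, (z i) ^ 2) ∂stdGaussian d)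
      = 2 * (d : ℝ) / (((d : ℝ) - 1) * realBeta (1 / 2) (((d : ℝ) - 1) / 2)) := by
  obtain ⟨n, rfl⟩ : ∃ n, d = n + 2 := ⟨d - 2, by omega⟩
  let g : EuclideanSpace ℝ (Fin (n + 2)) → ℝ := fun x ↦ ∑ i, |x i|
  let σ := (volume : Measure (EuclideanSpace ℝ (Fin (n + 2)))).toSphere
  have hg (x : EuclideanSpace ℝ (Fin (n + 2))) : g (‖x‖⁻¹ • x) = g x / ‖x‖ := by
    simp [g, abs_mul, ← Finset.mul_sum]
    ring
  have hratio : ∫ z, (∑ i, |z i|) / √(∑ i, (z i) ^ 2) ∂stdGaussian (n + 2) =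
      (√(2 * π))⁻¹ ^ (n + 2) * ((∫ u, g u ∂σ) *
        ∫ y in Set.Ioi (0 : ℝ), y ^ (n + 1) * exp (-(1 / 2) * y ^ 2)) := by
    have h := integral_norm_mul_direction (volume : Measure (EuclideanSpace ℝ (Fin (n + 2))))
      (fun y ↦ exp (-(1 / 2) * y ^ 2)) g
    rw [finrank_euclideanSpace_fin] at h
    simp only [hg] at h
    rw [← Nat.add_sub_cancel (n := n + 1) (m := 1), ← h,
      ← integral_stdGaussian (n + 2) fun x ↦ g x / ‖x‖]
    simp [g, EuclideanSpace.norm_eq]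
  have hnorm : ∫ z, ∑ i, |z i| ∂stdGaussian (n + 2) =
      (√(2 * π))⁻¹ ^ (n + 2) * ((∫ u, g u ∂σ) *
        ∫ y in Set.Ioi (0 : ℝ), y ^ (n + 2) * exp (-(1 / 2) * y ^ 2)) := by
    have h := integral_norm_mul_direction (volume : Measure (EuclideanSpace ℝ (Fin (n + 2))))
      (fun y ↦ y * exp (-(1 / 2) * y ^ 2)) g
    rw [finrank_euclideanSpace_fin] at h
    have hx (x : EuclideanSpace ℝ (Fin (n + 2))) : g x / ‖x‖ * (‖x‖ * exp (-(1 / 2) * ‖x‖ ^ 2)) =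
        g x * exp (-(1 / 2) * ‖x‖ ^ 2) := by
      rcases eq_or_ne x 0 with rfl | hx
      · simp [g]
      · have := norm_ne_zero_iff.mpr hx
        field_simp
    simp only [hg, hx, ← mul_assoc, ← pow_succ,
      show n + 2 - 1 + 1 = n + 2 by omega] at h
    rw [← h, ← integral_stdGaussian (n + 2) g]
  rw [integral_sum_abs_stdGaussian, integral_pow_mul_exp_neg_half_sq] at hnorm
  rw [hratio, integral_pow_mul_exp_neg_half_sq]
  set S := ∫ u, g u ∂σ
  clear_value S
  have hpow : (1 / 2 : ℝ) ^ (-((n + 2 : ℕ) + 1 : ℝ) / 2) =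
      (1 / 2) ^ (-((n + 1 : ℕ) + 1 : ℝ) / 2) * √2 := by
    have hsqrt : √2 = (1 / 2 : ℝ) ^ (-(1 / 2) : ℝ) := by
      rw [one_div, inv_rpow zero_le_two, rpow_neg zero_le_two, inv_inv, sqrt_eq_rpow, one_div]
    rw [hsqrt, ← rpow_add (by norm_num)]
    congr 1
    push_cast
    ring
  have hGamma : Gamma (((n + 2 : ℕ) + 1 : ℝ) / 2) =
      ((n : ℝ) + 1) / 2 * Gamma (((n : ℝ) + 1) / 2) := by
    rw [← Gamma_add_one (by positivity)]
    congr 1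
    push_cast
    ring
  have hG : 0 < Gamma (((n : ℝ) + 1) / 2) := Gamma_pos_of_pos (by positivity)
  have hH : 0 < Gamma (((n : ℝ) + 2) / 2) := Gamma_pos_of_pos (by positivity)
  clear hratio
  generalize (√(2 * π))⁻¹ ^ (n + 2) = A at hnorm ⊢
  rw [hpow, hGamma, sqrt_mul zero_le_two] at hnorm
  have hcast : ((n + 1 : ℕ) + 1 : ℝ) = n + 2 := by push_cast; ring
  rw [hcast] at hnorm ⊢
  rw [realBeta, Gamma_one_half_eq,
    show ((n + 2 : ℕ) - 1 : ℝ) = n + 1 by push_cast; ring,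
    show (1 / 2 + ((n : ℝ) + 1) / 2) = (n + 2) / 2 by ring]
  generalize (1 / 2 : ℝ) ^ (-((n : ℝ) + 2) / 2) = P at hnorm ⊢
  have hpi : 0 < √π := sqrt_pos.mpr pi_pos
  have htwo : √(2 : ℝ) ^ 2 = 2 := sq_sqrt zero_le_two
  have hn : (0 : ℝ) < n + 1 := by positivity
  have hprod : A * S * P * (√π * (n + 1) * Gamma (((n : ℝ) + 1) / 2)) = 4 * (n + 2 : ℕ) := by
    field_simp at hnorm
    rw [htwo] at hnorm
    linarith
  field_simp
  linear_combination hprod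
end

section
/- For every d ≥ 2, 2d/((d−1)·B(1/2,(d−1)/2)) ≥ √(2d/π), where B denotes the Beta function. Consequently, for T = Z/‖Z‖₂ uniform on the unit sphere S^{d−1} (Z standard Gaussian in ℝ^d), the deterministic-scale vNMSE bound holds for every dimension: d/(E[‖T‖₁])² − 1 = d·((d−1)·B(1/2,(d−1)/2)/(2d))² − 1 ≤ π/2 − 1. -/
open Real

/-- Midpoint log-convexity of the Gamma function, combined with its functional equation. -/
theorem Gamma_add_half_sq_le {x : ℝ} (hx : 0 < x) :
    Real.Gamma (x + 1 / 2) ^ 2 ≤ x * Real.Gamma x ^ 2 := by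
  have hG := Real.Gamma_pos_of_pos hx
  have h := Real.Gamma_mul_add_mul_le_rpow_Gamma_mul_rpow_Gamma (s := x) (t := x + 1)
    (a := 1 / 2) (b := 1 / 2) hx (by linarith) (by norm_num) (by norm_num) (by norm_num)
  rw [← Real.sqrt_eq_rpow, ← Real.sqrt_eq_rpow, ← Real.sqrt_mul hG.le,
    Real.Gamma_add_one hx.ne', show 1 / 2 * x + 1 / 2 * (x + 1) = x + 1 / 2 by ring] at h
  calc Real.Gamma (x + 1 / 2) ^ 2
      ≤ √(Real.Gamma x * (x * Real.Gamma x)) ^ 2 :=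
        pow_le_pow_left₀ (Real.Gamma_pos_of_pos (by linarith)).le h 2
    _ = x * Real.Gamma x ^ 2 := by
        rw [Real.sq_sqrt (by positivity)]
        ring

theorem sub_one_mul_realBeta_pos {t : ℝ} (ht : 1 < t) :
    0 < (t - 1) * realBeta (1 / 2) ((t - 1) / 2) := by
  have h₁ : 0 < t - 1 := by linarith
  have h₂ := Real.Gamma_pos_of_pos (half_pos h₁)
  have h₃ := Real.Gamma_pos_of_pos (show (0 : ℝ) < 1 / 2 by norm_num)
  have h₄ := Real.Gamma_pos_of_pos (show 0 < 1 / 2 + (t - 1) / 2 by linarith)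
  unfold realBeta
  positivity

theorem sub_one_mul_realBeta_eq {t : ℝ} (ht : 1 < t) :
    (t - 1) * realBeta (1 / 2) ((t - 1) / 2)
      = 2 * √π * (Real.Gamma (t / 2 + 1 / 2) / Real.Gamma (t / 2)) := by
  have h := Real.Gamma_add_one (s := (t - 1) / 2) (by linarith)
  rw [show (t - 1) / 2 + 1 = t / 2 + 1 / 2 by ring] at h
  rw [h, realBeta, Real.Gamma_one_half_eq, show 1 / 2 + (t - 1) / 2 = t / 2 by ring]
  ring

theorem sub_one_mul_realBeta_sq_le {t : ℝ} (ht : 1 < t) :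
    ((t - 1) * realBeta (1 / 2) ((t - 1) / 2)) ^ 2 ≤ 2 * π * t := by
  have hx : 0 < t / 2 := by linarith
  have hG := Real.Gamma_pos_of_pos hx
  have h : (Real.Gamma (t / 2 + 1 / 2) / Real.Gamma (t / 2)) ^ 2 ≤ t / 2 := by
    rw [div_pow, div_le_iff₀ (by positivity)]
    exact Gamma_add_half_sq_le hx
  rw [sub_one_mul_realBeta_eq ht, mul_pow, mul_pow, Real.sq_sqrt Real.pi_pos.le]
  nlinarith [Real.pi_pos]

theorem sphere_l1_expectation_lower_bound (d : ℕ) (hd : 2 ≤ d) :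
    Real.sqrt (2 * (d : ℝ) / π)
        ≤ 2 * (d : ℝ) / (((d : ℝ) - 1) * realBeta (1 / 2) (((d : ℝ) - 1) / 2)) ∧
    (d : ℝ) * ((((d : ℝ) - 1) * realBeta (1 / 2) (((d : ℝ) - 1) / 2)) / (2 * (d : ℝ))) ^ 2 - 1
        ≤ π / 2 - 1 := by
  have ht : (1 : ℝ) < d := by exact_mod_cast hd
  have hpos := sub_one_mul_realBeta_pos ht
  have hsq := sub_one_mul_realBeta_sq_le ht
  set X := ((d : ℝ) - 1) * realBeta (1 / 2) (((d : ℝ) - 1) / 2)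
  have hd0 : (0 : ℝ) < d := by linarith
  constructor
  · refine Real.sqrt_le_iff.mpr ⟨by positivity, ?_⟩
    rw [div_pow, div_le_div_iff₀ Real.pi_pos (by positivity)]
    nlinarith
  · have h : (d : ℝ) * (X / (2 * d)) ^ 2 = X ^ 2 / (4 * d) := by
      field_simp
      ring
    rw [h, sub_le_sub_iff_right, div_le_iff₀ (by positivity)]
    linarith
end
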